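/- arXiv:2504.18438 — 2 statements merged into one kernel-verified Lean document; each statement's English description precedes it below -/
import Mathlib

section
/- Let p be an even positive integer, q a positive integer, b_q < 0 and c_r > 0 real numbers. Set H_0(v) := −p c_r + q b_q v + q v^{p+1}, v_± := ±(−b_q/(p+1))^{1/p}, and ĉ := q(−b_q/(p+1))^{(p+1)/p}. Then: (Z1) if c_r > ĉ, H_0 has exactly one real zero; it is simple and lies in (v_+, ∞); (Z2) if c_r = ĉ, the real zeros of H_0 are exactly v_− and one point z > v_+, where H_0(v_−) = H_0'(v_−) = 0 with H_0''(v_−) ≠ 0 (a double zero) and z is simple; (Z3) if 0 < c_r < ĉ, H_0 has exactly three real zeros z₁ < z₂ < z₃, all simple, with z₁ < v_− < z₂ < 0 < v_+ < z₃; in particular two are negative and one is positive. -/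
open Set

/-- The polynomial `v ↦ -p c - q (p + 1) s^p v + q v^(p + 1)`, with critical points `±s` for
even `p`. -/
noncomputable def trinomial (p q : ℕ) (c s v : ℝ) : ℝ :=
  -(p : ℝ) * c - (q : ℝ) * (p + 1) * s ^ p * v + (q : ℝ) * v ^ (p + 1)

namespace trinomial

variable {p q : ℕ} {c s v : ℝ}

theorem hasDerivAt (p q : ℕ) (c s v : ℝ) :
    HasDerivAt (trinomial p q c s) ((q : ℝ) * (p + 1) * (v ^ p - s ^ p)) v := by
  have h := (((hasDerivAt_id v).const_mul ((q : ℝ) * (p + 1) * s ^ p)).const_sub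
    (-(p : ℝ) * c)).add ((hasDerivAt_pow (p + 1) v).const_mul (q : ℝ))
  refine h.congr_deriv ?_
  push_cast
  ring

theorem deriv_eq (p q : ℕ) (c s : ℝ) :
    deriv (trinomial p q c s) = fun v => (q : ℝ) * (p + 1) * (v ^ p - s ^ p) :=
  funext fun v => (hasDerivAt p q c s v).deriv

theorem deriv_deriv (p q : ℕ) (c s v : ℝ) :
    deriv (deriv (trinomial p q c s)) v = (q : ℝ) * (p + 1) * (p * v ^ (p - 1)) := by
  rw [deriv_eq]
  exact (((hasDerivAt_pow p v).sub_const (s ^ p)).const_mul _).deriv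

theorem continuous (p q : ℕ) (c s : ℝ) : Continuous (trinomial p q c s) :=
  continuous_iff_continuousAt.2 fun v => (hasDerivAt p q c s v).continuousAt

theorem deriv_pos (hp : 0 < p) (hpe : Even p) (hq : 0 < q) (hs : 0 < s) (h : s < |v|) :
    0 < deriv (trinomial p q c s) v := by
  have h1 : s ^ p < v ^ p := by
    rw [← hpe.pow_abs v]
    exact pow_lt_pow_left₀ h hs.le hp.ne'
  have : (0 : ℝ) < q := by exact_mod_cast hq
  rw [deriv_eq]
  exact mul_pos (by positivity) (sub_pos.2 h1)

theorem deriv_neg (hp : 0 < p) (hpe : Even p) (hq : 0 < q) (h : |v| < s) :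
    deriv (trinomial p q c s) v < 0 := by
  have h1 : v ^ p < s ^ p := by
    rw [← hpe.pow_abs v]
    exact pow_lt_pow_left₀ h (abs_nonneg v) hp.ne'
  have : (0 : ℝ) < q := by exact_mod_cast hq
  rw [deriv_eq]
  exact mul_neg_of_pos_of_neg (by positivity) (sub_neg.2 h1)

theorem strictMonoOn_Iic (hp : 0 < p) (hpe : Even p) (hq : 0 < q) (hs : 0 < s) :
    StrictMonoOn (trinomial p q c s) (Iic (-s)) := by
  refine strictMonoOn_of_deriv_pos (convex_Iic _) (continuous p q c s).continuousOn fun v hv => ?_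
  rw [interior_Iic, mem_Iio] at hv
  exact deriv_pos hp hpe hq hs (lt_abs.2 (Or.inr (by linarith)))

theorem strictAntiOn_Icc (hp : 0 < p) (hpe : Even p) (hq : 0 < q) :
    StrictAntiOn (trinomial p q c s) (Icc (-s) s) := by
  refine strictAntiOn_of_deriv_neg (convex_Icc _ _) (continuous p q c s).continuousOn
    fun v hv => ?_
  rw [interior_Icc] at hv
  exact deriv_neg hp hpe hq (abs_lt.2 hv)

theorem strictMonoOn_Ici (hp : 0 < p) (hpe : Even p) (hq : 0 < q) (hs : 0 < s) :
    StrictMonoOn (trinomial p q c s) (Ici s) := by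
  refine strictMonoOn_of_deriv_pos (convex_Ici _) (continuous p q c s).continuousOn fun v hv => ?_
  rw [interior_Ici, mem_Ioi] at hv
  exact deriv_pos hp hpe hq hs (lt_abs.2 (Or.inl hv))

theorem apply_neg_self (hpe : Even p) :
    trinomial p q c s (-s) = p * (q * s ^ (p + 1) - c) := by
  rw [trinomial, hpe.add_one.neg_pow]
  ring

theorem apply_self_neg (hp : 0 < p) (hs : 0 < s) (hc : 0 < c) :
    trinomial p q c s s < 0 := by
  have h : trinomial p q c s s = -(p * (q * s ^ (p + 1) + c)) := by
    rw [trinomial]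
    ring
  have : (0 : ℝ) < p := by exact_mod_cast hp
  rw [h, neg_lt_zero]
  positivity

theorem exists_sign_change (hp : 0 < p) (hpe : Even p) (hq : 0 < q) (hs : 0 < s) (hc : 0 < c) :
    ∃ M, s < M ∧ 0 < trinomial p q c s M ∧ trinomial p q c s (-M) < 0 := by
  have hpc : 0 < p * c := mul_pos (by exact_mod_cast hp) hc
  have hps : 0 < (p + 1) * s ^ p := by positivity
  have hq1 : (1 : ℝ) ≤ q := by exact_mod_cast hq
  obtain ⟨M, hM⟩ : ∃ M, M = 1 + (p + 1) * s ^ p + p * c + s := ⟨_, rfl⟩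
  have hMp : M ≤ M ^ p := le_self_pow₀ (by linarith) hp.ne'
  have h1 : 1 ≤ M ^ p - (p + 1) * s ^ p := by linarith
  have h2 : M ≤ q * M * (M ^ p - (p + 1) * s ^ p) := by
    have hM0 : 0 ≤ M := by linarith
    nlinarith [mul_le_mul_of_nonneg_right hq1 hM0,
      mul_le_mul_of_nonneg_left h1 (mul_nonneg (by linarith : (0 : ℝ) ≤ q) hM0)]
  have e1 : trinomial p q c s M = q * M * (M ^ p - (p + 1) * s ^ p) - p * c := by
    rw [trinomial]
    ring
  have e2 : trinomial p q c s (-M) = -(q * M * (M ^ p - (p + 1) * s ^ p)) - p * c := by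
    rw [trinomial, hpe.add_one.neg_pow]
    ring
  exact ⟨M, by linarith, by linarith, by linarith⟩

theorem exists_zero_gt (hp : 0 < p) (hpe : Even p) (hq : 0 < q) (hs : 0 < s) (hc : 0 < c) :
    ∃ z, s < z ∧ trinomial p q c s z = 0 ∧ deriv (trinomial p q c s) z ≠ 0 ∧
      ∀ w, s ≤ w → trinomial p q c s w = 0 → w = z := by
  obtain ⟨M, hM, hpos, -⟩ := exists_sign_change hp hpe hq hs hc
  obtain ⟨z, hz, hz0⟩ := intermediate_value_Ioo hM.le (continuous p q c s).continuousOn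
    ⟨apply_self_neg hp hs hc, hpos⟩
  exact ⟨z, hz.1, hz0, (deriv_pos hp hpe hq hs (lt_abs.2 (Or.inl hz.1))).ne', fun w hw h =>
    (strictMonoOn_Ici hp hpe hq hs).injOn hw hz.1.le (h.trans hz0.symm)⟩

theorem le_apply_neg_self (hp : 0 < p) (hpe : Even p) (hq : 0 < q) (hs : 0 < s) (hv : v ≤ s) :
    trinomial p q c s v ≤ trinomial p q c s (-s) := by
  rcases le_total v (-s) with h | h
  · exact (strictMonoOn_Iic hp hpe hq hs).monotoneOn h self_mem_Iic h
  · exact (strictAntiOn_Icc hp hpe hq).antitoneOn ⟨le_rfl, by linarith⟩ ⟨h, hv⟩ h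

theorem zeros_of_lt (hp : 0 < p) (hpe : Even p) (hq : 0 < q) (hs : 0 < s) (hc : 0 < c)
    (h : q * s ^ (p + 1) < c) :
    ∃ z, trinomial p q c s z = 0 ∧ s < z ∧ deriv (trinomial p q c s) z ≠ 0 ∧
      ∀ w, trinomial p q c s w = 0 → w = z := by
  obtain ⟨z, hz, hz0, hd, hu⟩ := exists_zero_gt hp hpe hq hs hc
  refine ⟨z, hz0, hz, hd, fun w hw => hu w (le_of_not_ge fun hws => ?_) hw⟩
  have h1 := le_apply_neg_self (c := c) hp hpe hq hs hws
  rw [hw, apply_neg_self hpe] at h1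
  exact h1.not_gt (mul_neg_of_pos_of_neg (by exact_mod_cast hp) (sub_neg.2 h))

theorem zeros_of_eq (hp : 0 < p) (hpe : Even p) (hq : 0 < q) (hs : 0 < s) (hc : 0 < c)
    (h : c = q * s ^ (p + 1)) :
    ∃ z, s < z ∧ trinomial p q c s z = 0 ∧ deriv (trinomial p q c s) z ≠ 0 ∧
      trinomial p q c s (-s) = 0 ∧ deriv (trinomial p q c s) (-s) = 0 ∧
      deriv (deriv (trinomial p q c s)) (-s) ≠ 0 ∧
      ∀ w, trinomial p q c s w = 0 → w = -s ∨ w = z := by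
  obtain ⟨z, hz, hz0, hd, hu⟩ := exists_zero_gt hp hpe hq hs hc
  have h0 : trinomial p q c s (-s) = 0 := by rw [apply_neg_self hpe, ← h, sub_self, mul_zero]
  refine ⟨z, hz, hz0, hd, h0, ?_, ?_, fun w hw => ?_⟩
  · simp [deriv_eq, hpe.neg_pow]
  · have hp' : (p : ℝ) ≠ 0 := by exact_mod_cast hp.ne'
    have hq' : (q : ℝ) ≠ 0 := by exact_mod_cast hq.ne'
    have hs' : -s ≠ 0 := neg_ne_zero.2 hs.ne'
    rw [deriv_deriv]
    positivity
  · rcases le_total w (-s) with h1 | h1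
    · exact Or.inl ((strictMonoOn_Iic hp hpe hq hs).injOn h1 self_mem_Iic (hw.trans h0.symm))
    rcases le_total w s with h2 | h2
    · exact Or.inl ((strictAntiOn_Icc hp hpe hq).injOn ⟨h1, h2⟩ ⟨le_rfl, by linarith⟩
        (hw.trans h0.symm))
    · exact Or.inr (hu w h2 hw)

theorem zeros_of_gt (hp : 0 < p) (hpe : Even p) (hq : 0 < q) (hs : 0 < s) (hc : 0 < c)
    (h : c < q * s ^ (p + 1)) :
    ∃ z₁ z₂ z₃, z₁ < z₂ ∧ z₂ < z₃ ∧ trinomial p q c s z₁ = 0 ∧ trinomial p q c s z₂ = 0 ∧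
      trinomial p q c s z₃ = 0 ∧ deriv (trinomial p q c s) z₁ ≠ 0 ∧
      deriv (trinomial p q c s) z₂ ≠ 0 ∧ deriv (trinomial p q c s) z₃ ≠ 0 ∧
      z₁ < -s ∧ -s < z₂ ∧ z₂ < 0 ∧ 0 < s ∧ s < z₃ ∧
      ∀ w, trinomial p q c s w = 0 → w = z₁ ∨ w = z₂ ∨ w = z₃ := by
  have hp' : (0 : ℝ) < p := by exact_mod_cast hp
  have hcont := continuous p q c s
  have hpos : 0 < trinomial p q c s (-s) := by
    rw [apply_neg_self hpe]
    exact mul_pos hp' (sub_pos.2 h)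
  have hzero : trinomial p q c s 0 < 0 := by
    simpa [trinomial] using mul_pos hp' hc
  obtain ⟨z₃, hz₃, hz₃0, hd₃, hu⟩ := exists_zero_gt hp hpe hq hs hc
  obtain ⟨M, hM, -, hneg⟩ := exists_sign_change hp hpe hq hs hc
  obtain ⟨z₁, hz₁, hz₁0⟩ := intermediate_value_Ioo (neg_le_neg hM.le) hcont.continuousOn
    ⟨hneg, hpos⟩
  obtain ⟨z₂, hz₂, hz₂0⟩ := intermediate_value_Ioo' (neg_nonpos.2 hs.le) hcont.continuousOn
    ⟨hzero, hpos⟩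
  have hz₂s : z₂ < s := hz₂.2.trans hs
  refine ⟨z₁, z₂, z₃, hz₁.2.trans hz₂.1, hz₂s.trans hz₃, hz₁0, hz₂0, hz₃0,
    (deriv_pos hp hpe hq hs (lt_abs.2 (Or.inr (by linarith [hz₁.2])))).ne',
    (deriv_neg hp hpe hq (abs_lt.2 ⟨hz₂.1, hz₂s⟩)).ne, hd₃, hz₁.2, hz₂.1, hz₂.2, hs, hz₃,
    fun w hw => ?_⟩
  rcases le_total w (-s) with h1 | h1
  · exact Or.inl ((strictMonoOn_Iic hp hpe hq hs).injOn h1 hz₁.2.le (hw.trans hz₁0.symm))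
  rcases le_total w s with h2 | h2
  · exact Or.inr (Or.inl ((strictAntiOn_Icc hp hpe hq).injOn ⟨h1, h2⟩ ⟨hz₂.1.le, hz₂s.le⟩
      (hw.trans hz₂0.symm)))
  · exact Or.inr (Or.inr (hu w h2 hw))

end trinomial


/-- Case analysis (Z1)-(Z3) of the real zeros of `H₀(v) = -p c_r + q b_q v + q v^(p+1)`
for `p` even positive, `q` positive, `b_q < 0` and `c_r > 0`, where
`v_± = ±(-b_q/(p+1))^(1/p)` and `ĉ = q(-b_q/(p+1))^((p+1)/p)`. -/
theorem stmt_5 (p q : ℕ) (hp : 0 < p) (hpe : Even p) (hq : 0 < q)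
    (bq cr : ℝ) (hb : bq < 0) (hc : 0 < cr)
    (H : ℝ → ℝ)
    (hH : H = fun v : ℝ => -(p : ℝ) * cr + (q : ℝ) * bq * v + (q : ℝ) * v ^ (p + 1))
    (s chat : ℝ)
    (hs : s = (-bq / ((p : ℝ) + 1)) ^ ((1 : ℝ) / (p : ℝ)))
    (hchat : chat = (q : ℝ) * (-bq / ((p : ℝ) + 1)) ^ (((p : ℝ) + 1) / (p : ℝ))) :
    -- (Z1) if `c_r > ĉ`, exactly one real zero, simple, in `(v₊, ∞)`
    (chat < cr → ∃ z : ℝ, H z = 0 ∧ s < z ∧ deriv H z ≠ 0 ∧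
        ∀ w : ℝ, H w = 0 → w = z) ∧
    -- (Z2) if `c_r = ĉ`, the zeros are exactly `v₋` (double) and one simple `z > v₊`
    (cr = chat → ∃ z : ℝ, s < z ∧ H z = 0 ∧ deriv H z ≠ 0 ∧
        H (-s) = 0 ∧ deriv H (-s) = 0 ∧ deriv (deriv H) (-s) ≠ 0 ∧
        ∀ w : ℝ, H w = 0 → w = -s ∨ w = z) ∧
    -- (Z3) if `0 < c_r < ĉ`, exactly three simple zeros `z₁ < v₋ < z₂ < 0 < v₊ < z₃`
    (cr < chat → ∃ z₁ z₂ z₃ : ℝ, z₁ < z₂ ∧ z₂ < z₃ ∧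
        H z₁ = 0 ∧ H z₂ = 0 ∧ H z₃ = 0 ∧
        deriv H z₁ ≠ 0 ∧ deriv H z₂ ≠ 0 ∧ deriv H z₃ ≠ 0 ∧
        z₁ < -s ∧ -s < z₂ ∧ z₂ < 0 ∧ 0 < s ∧ s < z₃ ∧
        ∀ w : ℝ, H w = 0 → w = z₁ ∨ w = z₂ ∨ w = z₃) := by
  have hp' : (p : ℝ) ≠ 0 := by exact_mod_cast hp.ne'
  have ha : 0 < -bq / ((p : ℝ) + 1) := div_pos (neg_pos.2 hb) (by positivity)
  have hs0 : 0 < s := hs ▸ Real.rpow_pos_of_pos ha _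
  have hsp : s ^ p = -bq / ((p : ℝ) + 1) := by
    rw [hs, one_div, Real.rpow_inv_natCast_pow ha.le hp.ne']
  have hch : chat = q * s ^ (p + 1) := by
    rw [hchat, hs, ← Real.rpow_natCast, ← Real.rpow_mul ha.le]
    congr 2
    push_cast
    ring
  have hHt : H = trinomial p q cr s := by
    rw [hH]
    funext v
    rw [trinomial, hsp]
    field_simp
    ring
  subst hHt hch
  exact ⟨trinomial.zeros_of_lt hp hpe hq hs0 hc, trinomial.zeros_of_eq hp hpe hq hs0 hc,
    trinomial.zeros_of_gt hp hpe hq hs0 hc⟩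
end

section
/- Let p be an even positive integer, q a positive integer, b_q < 0 and c_r < 0 real numbers. Set H_0(v) := −p c_r + q b_q v + q v^{p+1}, v_± := ±(−b_q/(p+1))^{1/p}, and ĉ := q(−b_q/(p+1))^{(p+1)/p}. Then: (Z4) if −ĉ < c_r < 0, H_0 has exactly three real zeros z₁ < z₂ < z₃, all simple, with z₁ < v_− < 0 < z₂ < v_+ < z₃; in particular one is negative and two are positive; (Z5) if c_r = −ĉ, the real zeros of H_0 are exactly one simple negative zero z < v_− and the double zero v_+ (H_0(v_+) = H_0'(v_+) = 0, H_0''(v_+) ≠ 0); (Z6) if c_r < −ĉ, H_0 has exactly one real zero; it is simple and lies in (−∞, v_−). -/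
/-- The polynomial `a + b (v^(p+1) - (p+1) s^p v)`, whose critical points are `±s` for `p` even. -/
def cuspPoly (p : ℕ) (a b s v : ℝ) : ℝ :=
  a + b * (v ^ (p + 1) - ((p : ℝ) + 1) * s ^ p * v)

namespace cuspPoly

variable {p : ℕ} {a b s : ℝ}

theorem hasDerivAt (p : ℕ) (a b s v : ℝ) :
    HasDerivAt (cuspPoly p a b s) (b * ((p : ℝ) + 1) * (v ^ p - s ^ p)) v := by
  have h := ((((hasDerivAt_pow (p + 1) v).sub
    ((hasDerivAt_id v).const_mul (((p : ℝ) + 1) * s ^ p))).const_mul b).const_add a)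
  refine h.congr_deriv ?_
  simp only [Nat.add_sub_cancel]
  push_cast
  ring

theorem deriv_eq (p : ℕ) (a b s v : ℝ) :
    deriv (cuspPoly p a b s) v = b * ((p : ℝ) + 1) * (v ^ p - s ^ p) :=
  (hasDerivAt p a b s v).deriv

theorem continuous (p : ℕ) (a b s : ℝ) : Continuous (cuspPoly p a b s) := by
  unfold cuspPoly
  fun_prop

theorem deriv_pos (hp : 0 < p) (hpe : Even p) (hb : 0 < b) (hs : 0 < s) {v : ℝ}
    (hv : s < |v|) : 0 < deriv (cuspPoly p a b s) v := by
  rw [deriv_eq, ← hpe.pow_abs v]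
  have := pow_lt_pow_left₀ hv hs.le hp.ne'
  exact mul_pos (by positivity) (by linarith)

theorem deriv_neg (hp : 0 < p) (hpe : Even p) (hb : 0 < b) {v : ℝ}
    (hv : |v| < s) : deriv (cuspPoly p a b s) v < 0 := by
  rw [deriv_eq, ← hpe.pow_abs v]
  have := pow_lt_pow_left₀ hv (abs_nonneg v) hp.ne'
  exact mul_neg_of_pos_of_neg (by positivity) (by linarith)

theorem strictMonoOn_Iic (hp : 0 < p) (hpe : Even p) (hb : 0 < b) (hs : 0 < s) :
    StrictMonoOn (cuspPoly p a b s) (Set.Iic (-s)) := by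
  refine strictMonoOn_of_deriv_pos (convex_Iic _) (continuous p a b s).continuousOn ?_
  intro v hv
  rw [interior_Iic, Set.mem_Iio] at hv
  exact deriv_pos hp hpe hb hs (lt_abs.2 (Or.inr (by linarith)))

theorem strictMonoOn_Ici (hp : 0 < p) (hpe : Even p) (hb : 0 < b) (hs : 0 < s) :
    StrictMonoOn (cuspPoly p a b s) (Set.Ici s) := by
  refine strictMonoOn_of_deriv_pos (convex_Ici _) (continuous p a b s).continuousOn ?_
  intro v hv
  rw [interior_Ici, Set.mem_Ioi] at hv
  exact deriv_pos hp hpe hb hs (lt_abs.2 (Or.inl hv))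

theorem strictAntiOn_Icc (hp : 0 < p) (hpe : Even p) (hb : 0 < b) :
    StrictAntiOn (cuspPoly p a b s) (Set.Icc (-s) s) := by
  refine strictAntiOn_of_deriv_neg (convex_Icc _ _) (continuous p a b s).continuousOn ?_
  intro v hv
  rw [interior_Icc] at hv
  exact deriv_neg hp hpe hb (abs_lt.2 hv)

theorem apply_zero (p : ℕ) (a b s : ℝ) : cuspPoly p a b s 0 = a := by
  simp [cuspPoly]

theorem apply_right (p : ℕ) (a b s : ℝ) :
    cuspPoly p a b s s = a - b * p * s ^ (p + 1) := by
  unfold cuspPoly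
  ring

theorem apply_left_pos (hp : 0 < p) (hpe : Even p) (ha : 0 < a) (hb : 0 < b) (hs : 0 < s) :
    0 < cuspPoly p a b s (-s) := by
  have h : cuspPoly p a b s 0 < cuspPoly p a b s (-s) :=
    strictAntiOn_Icc hp hpe hb ⟨le_rfl, by linarith⟩ ⟨by linarith, hs.le⟩ (by linarith)
  rw [apply_zero] at h
  exact ha.trans h

/-- Beyond some `M > s` the leading term dominates. -/
theorem exists_large (hp : 0 < p) (hpe : Even p) (ha : 0 < a) (hb : 0 < b) (hs : 0 < s) :
    ∃ M, s < M ∧ cuspPoly p a b s (-M) < 0 ∧ 0 < cuspPoly p a b s M := by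
  obtain ⟨c, hc, rfl⟩ : ∃ c, 0 < c ∧ a = b * c := ⟨a / b, by positivity, by field_simp⟩
  set k := ((p : ℝ) + 1) * s ^ p with hk
  have hk0 : 0 < k := by positivity
  obtain ⟨M, hM⟩ : ∃ M, M = 1 + s + k + c := ⟨_, rfl⟩
  have hMp : M ≤ M ^ p := le_self_pow₀ (by linarith) hp.ne'
  have key : c < M * (M ^ p - k) := by nlinarith
  refine ⟨M, by linarith, ?_, ?_⟩
  · have : cuspPoly p (b * c) b s (-M) = b * (c - M * (M ^ p - k)) := by
      rw [cuspPoly, hpe.add_one.neg_pow, hk]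
      ring
    rw [this]
    exact mul_neg_of_pos_of_neg hb (by linarith)
  · have : cuspPoly p (b * c) b s M = b * (c + M * (M ^ p - k)) := by
      rw [cuspPoly, hk]
      ring
    rw [this]
    exact mul_pos hb (by linarith)

theorem exists_zero_lt (hp : 0 < p) (hpe : Even p) (ha : 0 < a) (hb : 0 < b) (hs : 0 < s) :
    ∃ z < -s, cuspPoly p a b s z = 0 := by
  obtain ⟨M, hsM, hM, -⟩ := exists_large hp hpe ha hb hs
  obtain ⟨z, hz, hz0⟩ := intermediate_value_Ioo (show -M ≤ -s by linarith)
    (continuous p a b s).continuousOn ⟨hM, apply_left_pos hp hpe ha hb hs⟩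
  exact ⟨z, hz.2, hz0⟩

/-- To the right of `-s`, the value at `s` is the strict minimum. -/
theorem apply_right_lt (hp : 0 < p) (hpe : Even p) (hb : 0 < b) (hs : 0 < s) {w : ℝ}
    (hw : -s ≤ w) (hne : w ≠ s) : cuspPoly p a b s s < cuspPoly p a b s w := by
  rcases lt_or_gt_of_ne hne with h | h
  · exact strictAntiOn_Icc hp hpe hb ⟨hw, h.le⟩ ⟨by linarith, le_rfl⟩ h
  · exact strictMonoOn_Ici hp hpe hb hs Set.self_mem_Ici h.le h

theorem deriv_ne_zero_of_lt (hp : 0 < p) (hpe : Even p) (hb : 0 < b) (hs : 0 < s) {z : ℝ}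
    (hz : z < -s) : deriv (cuspPoly p a b s) z ≠ 0 :=
  (deriv_pos hp hpe hb hs (lt_abs.2 (Or.inr (by linarith)))).ne'

theorem deriv_deriv_right_ne_zero (hp : 0 < p) (hb : 0 < b) (hs : 0 < s) :
    deriv (deriv (cuspPoly p a b s)) s ≠ 0 := by
  have h : HasDerivAt (fun v => b * ((p : ℝ) + 1) * (v ^ p - s ^ p))
      (b * ((p : ℝ) + 1) * (p * s ^ (p - 1))) s :=
    ((hasDerivAt_pow p s).sub_const _).const_mul _
  rw [show deriv (cuspPoly p a b s) = _ from funext (deriv_eq p a b s), h.deriv]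
  positivity

theorem three_zeros (hp : 0 < p) (hpe : Even p) (ha : 0 < a) (hb : 0 < b) (hs : 0 < s)
    (hneg : cuspPoly p a b s s < 0) :
    ∃ z₁ z₂ z₃ : ℝ, z₁ < -s ∧ (0 < z₂ ∧ z₂ < s) ∧ s < z₃ ∧ cuspPoly p a b s z₁ = 0 ∧
      cuspPoly p a b s z₂ = 0 ∧ cuspPoly p a b s z₃ = 0 ∧
      ∀ w, cuspPoly p a b s w = 0 → w = z₁ ∨ w = z₂ ∨ w = z₃ := by
  obtain ⟨z₁, h₁, e₁⟩ := exists_zero_lt hp hpe ha hb hs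
  obtain ⟨M, hsM, -, hM⟩ := exists_large hp hpe ha hb hs
  obtain ⟨z₂, h₂, e₂⟩ := intermediate_value_Ioo' hs.le
    (continuous p a b s).continuousOn ⟨hneg, (apply_zero p a b s).symm ▸ ha⟩
  obtain ⟨z₃, h₃, e₃⟩ := intermediate_value_Ioo hsM.le
    (continuous p a b s).continuousOn ⟨hneg, hM⟩
  refine ⟨z₁, z₂, z₃, h₁, h₂, h₃.1, e₁, e₂, e₃, fun w hw => ?_⟩
  rcases le_total w (-s) with h | h
  · exact Or.inl ((strictMonoOn_Iic hp hpe hb hs).injOn h h₁.le (hw.trans e₁.symm))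
  rcases le_total w s with h' | h'
  · exact Or.inr (Or.inl ((strictAntiOn_Icc hp hpe hb).injOn ⟨h, h'⟩
      ⟨by linarith [h₂.1], h₂.2.le⟩ (hw.trans e₂.symm)))
  · exact Or.inr (Or.inr ((strictMonoOn_Ici hp hpe hb hs).injOn h' h₃.1.le
      (hw.trans e₃.symm)))

/-- If the local minimum is nonnegative, the zeros lie among one `z < -s` and `s`. -/
theorem zeros_of_nonneg (hp : 0 < p) (hpe : Even p) (ha : 0 < a) (hb : 0 < b) (hs : 0 < s)
    (hnonneg : 0 ≤ cuspPoly p a b s s) :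
    ∃ z < -s, cuspPoly p a b s z = 0 ∧ ∀ w, cuspPoly p a b s w = 0 → w = z ∨ w = s := by
  obtain ⟨z, h, e⟩ := exists_zero_lt hp hpe ha hb hs
  refine ⟨z, h, e, fun w hw => ?_⟩
  rcases le_total w (-s) with h' | h'
  · exact Or.inl ((strictMonoOn_Iic hp hpe hb hs).injOn h' h.le (hw.trans e.symm))
  · refine Or.inr (by_contra fun hne => ?_)
    linarith [apply_right_lt (a := a) hp hpe hb hs h' hne]

end cuspPoly

/-- Case analysis (Z4)-(Z6) of the real zeros of `H₀(v) = -p c_r + q b_q v + q v^(p+1)`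
for `p` even positive, `q` positive, `b_q < 0` and `c_r < 0`, where
`v_± = ±(-b_q/(p+1))^(1/p)` and `ĉ = q(-b_q/(p+1))^((p+1)/p)`. -/
theorem stmt_6 (p q : ℕ) (hp : 0 < p) (hpe : Even p) (hq : 0 < q)
    (bq cr : ℝ) (hb : bq < 0) (hc : cr < 0)
    (H : ℝ → ℝ)
    (hH : H = fun v : ℝ => -(p : ℝ) * cr + (q : ℝ) * bq * v + (q : ℝ) * v ^ (p + 1))
    (s chat : ℝ)
    (hs : s = (-bq / ((p : ℝ) + 1)) ^ ((1 : ℝ) / (p : ℝ)))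
    (hchat : chat = (q : ℝ) * (-bq / ((p : ℝ) + 1)) ^ (((p : ℝ) + 1) / (p : ℝ))) :
    -- (Z4) if `-ĉ < c_r < 0`, exactly three simple zeros `z₁ < v₋ < 0 < z₂ < v₊ < z₃`
    (-chat < cr → ∃ z₁ z₂ z₃ : ℝ, z₁ < z₂ ∧ z₂ < z₃ ∧
        H z₁ = 0 ∧ H z₂ = 0 ∧ H z₃ = 0 ∧
        deriv H z₁ ≠ 0 ∧ deriv H z₂ ≠ 0 ∧ deriv H z₃ ≠ 0 ∧
        z₁ < -s ∧ -s < 0 ∧ 0 < z₂ ∧ z₂ < s ∧ s < z₃ ∧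
        ∀ w : ℝ, H w = 0 → w = z₁ ∨ w = z₂ ∨ w = z₃) ∧
    -- (Z5) if `c_r = -ĉ`, the zeros are exactly one simple `z < v₋` and the double zero `v₊`
    (cr = -chat → ∃ z : ℝ, z < -s ∧ H z = 0 ∧ deriv H z ≠ 0 ∧
        H s = 0 ∧ deriv H s = 0 ∧ deriv (deriv H) s ≠ 0 ∧
        ∀ w : ℝ, H w = 0 → w = z ∨ w = s) ∧
    -- (Z6) if `c_r < -ĉ`, exactly one real zero, simple, in `(-∞, v₋)`
    (cr < -chat → ∃ z : ℝ, H z = 0 ∧ z < -s ∧ deriv H z ≠ 0 ∧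
        ∀ w : ℝ, H w = 0 → w = z) := by
  have hp' : (0 : ℝ) < p := Nat.cast_pos.2 hp
  have hq' : (0 : ℝ) < q := Nat.cast_pos.2 hq
  have hbase : 0 < -bq / ((p : ℝ) + 1) := div_pos (by linarith) (by linarith)
  have hs0 : 0 < s := hs ▸ Real.rpow_pos_of_pos hbase _
  have hsp : s ^ p = -bq / ((p : ℝ) + 1) := by
    rw [hs, one_div, Real.rpow_inv_natCast_pow hbase.le hp.ne']
  have hch : chat = q * s ^ (p + 1) := by
    rw [hchat, hs, ← Real.rpow_mul_natCast hbase.le]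
    push_cast
    rw [one_div_mul_eq_div]
  have ha : 0 < -(p : ℝ) * cr := mul_pos_of_neg_of_neg (by linarith) hc
  have hHp : H = cuspPoly p (-(p : ℝ) * cr) q s := by
    rw [hH]
    funext v
    rw [cuspPoly, hsp]
    field_simp
    ring
  have hHs : H s = -p * (cr + chat) := by
    rw [hHp, cuspPoly.apply_right, hch]
    ring
  clear hH
  subst hHp
  refine ⟨fun h => ?_, fun h => ?_, fun h => ?_⟩
  · obtain ⟨z₁, z₂, z₃, h₁, h₂, h₃, e₁, e₂, e₃, huniq⟩ :=
      cuspPoly.three_zeros hp hpe ha hq' hs0 (by rw [hHs]; nlinarith)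
    exact ⟨z₁, z₂, z₃, by linarith, by linarith, e₁, e₂, e₃,
      cuspPoly.deriv_ne_zero_of_lt hp hpe hq' hs0 h₁,
      (cuspPoly.deriv_neg hp hpe hq' (abs_lt.2 ⟨by linarith, h₂.2⟩)).ne,
      (cuspPoly.deriv_pos hp hpe hq' hs0 (lt_abs.2 (Or.inl h₃))).ne',
      h₁, by linarith, h₂.1, h₂.2, h₃, huniq⟩
  · have hs_zero : cuspPoly p (-(p : ℝ) * cr) q s s = 0 := by rw [hHs, h]; ring
    obtain ⟨z, hz, e, huniq⟩ := cuspPoly.zeros_of_nonneg hp hpe ha hq' hs0 hs_zero.ge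
    exact ⟨z, hz, e, cuspPoly.deriv_ne_zero_of_lt hp hpe hq' hs0 hz, hs_zero,
      by rw [cuspPoly.deriv_eq]; ring, cuspPoly.deriv_deriv_right_ne_zero hp hq' hs0, huniq⟩
  · have hs_pos : 0 < cuspPoly p (-(p : ℝ) * cr) q s s := by rw [hHs]; nlinarith
    obtain ⟨z, hz, e, huniq⟩ := cuspPoly.zeros_of_nonneg hp hpe ha hq' hs0 hs_pos.le
    refine ⟨z, e, hz, cuspPoly.deriv_ne_zero_of_lt hp hpe hq' hs0 hz, fun w hw => ?_⟩
    exact (huniq w hw).resolve_right fun hws => hs_pos.ne' (hws ▸ hw)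
end
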